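/- Fix n ≥ 1 and assume stability of the Steiner polynomial holds in dimension n: for every convex body L ⊆ ℝⁿ with nonempty interior and every real polynomial Q of degree at most n with Q(t) = vol(L + tB) for all t ≥ 0, every complex root of Q has strictly negative real part. Let K ⊆ ℝⁿ be a convex body with nonempty interior, let c > 0, and suppose K is a Minkowski summand of cB (there exists a convex body M with M + K = cB, where cB is the closed ball of radius c centered at 0). If P is a real polynomial of degree at most n with P(t) = vol(K + tB) for all t ≥ 0, then every complex root z of P satisfies Re z ≥ −c. (Lower bound of the main theorem: the real parts of the roots of the Steiner polynomial are at least −ρ_max.) -/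

import Mathlib

open MeasureTheory Metric Pointwise

section GradientPotential

variable {E : Type*} [NormedAddCommGroup E] [InnerProductSpace ℝ E]

/-- `f` is a potential whose gradient `g` maps the whole space into `K`, strictly monotonically and
differentiably with derivative `g'`, and which dominates every linear form given by an interior
point of `K`. -/
structure IsGradientPotential (K : Set E) (f : E → ℝ) (g : E → E) (g' : E → E →L[ℝ] E) :
    Prop where
  hasFDerivAt : ∀ x, HasFDerivAt f (innerSL ℝ (g x)) x
  hasFDerivAt_grad : ∀ x, HasFDerivAt g (g' x) x
  grad_mem : ∀ x, g x ∈ K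
  inner_pos : ∀ x y, x ≠ y → 0 < inner ℝ (g x - g y) (x - y)
  coercive : ∀ q ∈ interior K, ∃ ε > 0, ∃ C, ∀ x, ε * ‖x‖ - C ≤ f x - inner ℝ q x

theorem IsGradientPotential.inner_add_smul_pos {K M : Set E} {f₁ f₂ : E → ℝ}
    {g₁ g₂ : E → E} {g₁' g₂' : E → E →L[ℝ] E} (h₁ : IsGradientPotential K f₁ g₁ g₁')
    (h₂ : IsGradientPotential M f₂ g₂ g₂') {s : ℝ} (hs : 0 ≤ s) {x y : E} (hxy : x ≠ y) :
    0 < inner ℝ ((g₁ x + s • g₂ x) - (g₁ y + s • g₂ y)) (x - y) := by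
  have : (g₁ x + s • g₂ x) - (g₁ y + s • g₂ y) = (g₁ x - g₁ y) + s • (g₂ x - g₂ y) := by
    rw [smul_sub]; abel
  rw [this, inner_add_left, inner_smul_left]
  exact add_pos_of_pos_of_nonneg (h₁.inner_pos x y hxy)
    (mul_nonneg hs (h₂.inner_pos x y hxy).le)

theorem inner_fderiv_nonneg_of_monotone {T : E → E} {A : E →L[ℝ] E} {x : E}
    (hT : HasFDerivAt T A x) (hmono : ∀ y, 0 ≤ inner ℝ (T y - T x) (y - x)) (v : E) :
    0 ≤ inner ℝ (A v) v := by
  refine ge_of_tendsto ((hT.hasLineDerivAt v).tendsto_slope_zero_right.inner (𝕜 := ℝ)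
    (tendsto_const_nhds (x := v))) ?_
  filter_upwards [self_mem_nhdsWithin] with t ht
  have ht0 : 0 < t := ht
  have h := hmono (x + t • v)
  rw [add_sub_cancel_left, inner_smul_right] at h
  rw [inner_smul_left, conj_trivial]
  exact mul_nonneg (inv_nonneg.2 ht0.le) (nonneg_of_mul_nonneg_right h ht0)

variable [FiniteDimensional ℝ E]

theorem det_nonneg_of_inner_nonneg {A : E →L[ℝ] E} (hA : ∀ v, 0 ≤ inner ℝ (A v) v) :
    0 ≤ A.det := by
  by_contra! hneg
  have hcont : Continuous fun t : ℝ => (t • A + (1 - t) • ContinuousLinearMap.id ℝ E).det :=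
    ContinuousLinearMap.continuous_det.comp (by fun_prop)
  obtain ⟨t, ht, h0⟩ := intermediate_value_Icc' zero_le_one hcont.continuousOn
    (show (0 : ℝ) ∈ Set.Icc _ _ from ⟨by simpa using hneg.le, by simp [ContinuousLinearMap.det]⟩)
  have ht1 : t < 1 := ht.2.lt_of_ne fun h => hneg.ne (by simpa [h] using h0)
  obtain ⟨v, hv, hv0⟩ := Submodule.exists_mem_ne_zero_of_ne_bot
    (LinearMap.bot_lt_ker_of_det_eq_zero h0).ne'
  have hv1 : t • A v + (1 - t) • v = 0 := by simpa using hv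
  have h := congrArg (fun w => inner ℝ w v) hv1
  simp only [inner_add_left, inner_smul_left, inner_zero_left, conj_trivial] at h
  have h1 := mul_nonneg ht.1 (hA v)
  have h2 := mul_pos (sub_pos.2 ht1) (real_inner_self_pos.2 hv0)
  linarith

theorem exists_polynomial_eval_eq_det (A B : E →L[ℝ] E) :
    ∃ p : Polynomial ℝ, p.natDegree ≤ Module.finrank ℝ E ∧
      ∀ s, p.eval s = (A + s • B).det := by
  let b := Module.finBasis ℝ E
  refine ⟨_, (Polynomial.natDegree_det_X_add_C_le (LinearMap.toMatrix b b B)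
    (LinearMap.toMatrix b b A)).trans_eq (Fintype.card_fin _), fun s => ?_⟩
  rw [← Polynomial.coe_evalRingHom, RingHom.map_det, ContinuousLinearMap.det,
    ← LinearMap.det_toMatrix b]
  congr 1
  ext i j
  simp [LinearMap.toMatrix_apply]
  ring

theorem IsGradientPotential.interior_add_smul_subset_range {K M : Set E} {f₁ f₂ : E → ℝ}
    {g₁ g₂ : E → E} {g₁' g₂' : E → E →L[ℝ] E} (h₁ : IsGradientPotential K f₁ g₁ g₁')
    (h₂ : IsGradientPotential M f₂ g₂ g₂') {s : ℝ} (hs : 0 ≤ s) :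
    interior K + s • interior M ⊆ Set.range fun x => g₁ x + s • g₂ x := by
  rintro _ ⟨q, hq, _, ⟨m, hm, rfl⟩, rfl⟩
  obtain ⟨ε, hε, C, hC⟩ := h₁.coercive q hq
  obtain ⟨δ, hδ, D, hD⟩ := h₂.coercive m hm
  let φ : E → ℝ := fun x => (f₁ x - inner ℝ q x) + s * (f₂ x - inner ℝ m x)
  have hder : ∀ x, HasFDerivAt φ ((innerSL ℝ (g₁ x) - innerSL ℝ q)
      + s • (innerSL ℝ (g₂ x) - innerSL ℝ m)) x := fun x =>
    ((h₁.hasFDerivAt x).sub (innerSL ℝ q).hasFDerivAt).add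
      (((h₂.hasFDerivAt x).sub (innerSL ℝ m).hasFDerivAt).const_mul s)
  have hlow : ∀ x, ε * ‖x‖ + (-C - s * D) ≤ φ x := fun x => by
    have h3 : -(s * D) ≤ s * (f₂ x - inner ℝ m x) := by
      rw [← mul_neg]
      exact mul_le_mul_of_nonneg_left
        (by linarith [hD x, mul_nonneg hδ.le (norm_nonneg x)]) hs
    have := hC x
    simp only [φ]
    linarith
  have hcont : Continuous φ := continuous_iff_continuousAt.2 fun x => (hder x).continuousAt
  obtain ⟨x, hx⟩ := hcont.exists_forall_le (Filter.tendsto_atTop_mono hlow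
    (Filter.tendsto_atTop_add_const_right _ _
      ((tendsto_norm_cocompact_atTop (E := E)).const_mul_atTop hε)))
  have h0 := IsLocalMin.hasFDerivAt_eq_zero (Filter.Eventually.of_forall hx) (hder x)
  refine ⟨x, ?_⟩
  have h1 : innerSL ℝ (g₁ x + s • g₂ x - (q + s • m)) = 0 := by
    rw [← h0]
    simp only [map_add, map_sub, map_smul, smul_sub]
    abel
  have h2 := DFunLike.congr_fun h1 (g₁ x + s • g₂ x - (q + s • m))
  exact sub_eq_zero.1 (inner_self_eq_zero.1 h2)

end GradientPotential

section Volume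

variable {E F : Type*} [NormedAddCommGroup E] [InnerProductSpace ℝ E] [FiniteDimensional ℝ E]
  [MeasurableSpace E] [BorelSpace E] [NormedAddCommGroup F] [NormedSpace ℝ F]

theorem integrableOn_exp_inner_smul {K : Set E} (hK : IsCompact K) {v : E → F}
    (hv : Continuous v) (x : E) :
    IntegrableOn (fun a => Real.exp (inner ℝ x a) • v a) K :=
  (by fun_prop :
    Continuous fun a => Real.exp (inner ℝ x a) • v a).continuousOn.integrableOn_compact hK

theorem hasFDerivAt_integral_exp_inner_smul [CompleteSpace F] {K : Set E} (hK : IsCompact K)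
    {v : E → F} (hv : Continuous v) (x : E) :
    HasFDerivAt (fun x => ∫ a in K, Real.exp (inner ℝ x a) • v a)
      (∫ a in K, Real.exp (inner ℝ x a) • (innerSL ℝ a).smulRight (v a)) x := by
  have hw : Continuous fun a : E => (innerSL ℝ a).smulRight (v a) := by
    exact (ContinuousLinearMap.smulRightL ℝ E F).continuous₂.comp
      ((innerSL ℝ (E := E)).continuous.prodMk hv)
  obtain ⟨C, hC⟩ := (((isCompact_closedBall x 1).prod hK).bddAbove_image
    (f := fun p : E × E => ‖Real.exp (inner ℝ p.1 p.2) • (innerSL ℝ p.2).smulRight (v p.2)‖)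
    (by
      have := hw.comp (continuous_snd (X := E) (Y := E))
      exact Continuous.continuousOn (by fun_prop)))
  refine hasFDerivAt_integral_of_dominated_of_fderiv_le (bound := fun _ => C)
    (F' := fun x a => Real.exp (inner ℝ x a) • (innerSL ℝ a).smulRight (v a))
    (closedBall_mem_nhds x one_pos)
    (Filter.Eventually.of_forall fun y => (integrableOn_exp_inner_smul hK hv y).aestronglyMeasurable)
    (integrableOn_exp_inner_smul hK hv x)
    (integrableOn_exp_inner_smul hK hw x).aestronglyMeasurable ?_ ?_ ?_
  · filter_upwards [ae_restrict_mem hK.measurableSet] with a ha y hy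
    exact hC ⟨(y, a), ⟨hy, ha⟩, rfl⟩
  · exact integrableOn_const (hs := hK.measure_ne_top)
  · refine Filter.Eventually.of_forall fun a y _ => ?_
    have h1 : HasFDerivAt (fun y : E => inner ℝ y a) (innerSL ℝ a) y := by
      simpa [real_inner_comm] using (innerSL ℝ a).hasFDerivAt (x := y)
    convert h1.exp.smul_const (v a) using 1
    ext z
    simp [smul_smul]

theorem laplace_pos {K : Set E} (hK : IsCompact K) (hKint : (interior K).Nonempty) (x : E) :
    0 < ∫ a in K, Real.exp (inner ℝ x a) := by
  have hint : IntegrableOn (fun a => Real.exp (inner ℝ x a)) K := by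
    simpa using integrableOn_exp_inner_smul hK (continuous_const (y := (1 : ℝ))) x
  rw [setIntegral_pos_iff_support_of_nonneg_ae
    (Filter.Eventually.of_forall fun a => (Real.exp_pos _).le) hint]
  have : Function.support (fun a => Real.exp (inner ℝ x a)) = Set.univ := by
    ext a; simp [Real.exp_ne_zero]
  rw [this, Set.univ_inter]
  exact Measure.measure_pos_of_nonempty_interior _ hKint

theorem laplace_barycenter_mem {K : Set E} (hK : IsCompact K) (hKconv : Convex ℝ K)
    (hKint : (interior K).Nonempty) (x : E) :
    (∫ a in K, Real.exp (inner ℝ x a))⁻¹ • ∫ a in K, Real.exp (inner ℝ x a) • a ∈ K := by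
  have hint : IntegrableOn (fun a => Real.exp (inner ℝ x a)) K := by
    simpa using integrableOn_exp_inner_smul hK (continuous_const (y := (1 : ℝ))) x
  have : NeZero (volume.restrict K) :=
    ⟨Measure.restrict_eq_zero.not.2 (Measure.measure_pos_of_nonempty_interior _ hKint).ne'⟩
  have := isProbabilityMeasure_tilted hint
  have hae : ∀ᵐ a ∂(volume.restrict K).tilted (fun a => inner ℝ x a), a ∈ K :=
    (tilted_absolutelyContinuous _ _).ae_le (ae_restrict_mem hK.measurableSet)
  obtain ⟨R, hR⟩ := hK.isBounded.exists_norm_le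
  have hmem := hKconv.integral_mem hK.isClosed hae
    (Integrable.of_bound aestronglyMeasurable_id R (hae.mono fun a ha => hR a ha))
  rw [integral_tilted] at hmem
  convert hmem using 1
  rw [← integral_smul]
  congr with a
  simp [smul_smul, div_eq_inv_mul]

theorem mul_laplace_lt_integral_exp_mul_inner {K : Set E} (hK : IsCompact K)
    (hKint : (interior K).Nonempty) {x y : E} (hxy : x ≠ y) {b : ℝ}
    (h : b * ∫ a in K, Real.exp (inner ℝ y a) =
      ∫ a in K, Real.exp (inner ℝ y a) * inner ℝ a (x - y)) :
    b * ∫ a in K, Real.exp (inner ℝ x a) <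
      ∫ a in K, Real.exp (inner ℝ x a) * inner ℝ a (x - y) := by
  have hc : ∀ {u : E → ℝ}, Continuous u → IntegrableOn u K := fun hu =>
    hu.continuousOn.integrableOn_compact hK
  rw [← integral_const_mul, ← sub_eq_zero, ← integral_sub (hc (by fun_prop)) (hc (by fun_prop))] at h
  have key : ∀ a, Real.exp (inner ℝ x a) * inner ℝ a (x - y) - b * Real.exp (inner ℝ x a)
      - Real.exp b * -(b * Real.exp (inner ℝ y a) - Real.exp (inner ℝ y a) * inner ℝ a (x - y))
      = Real.exp (inner ℝ y a) * ((Real.exp (inner ℝ a (x - y)) - Real.exp b)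
        * (inner ℝ a (x - y) - b)) := by
    intro a
    have : (inner ℝ x a : ℝ) = inner ℝ y a + inner ℝ a (x - y) := by
      rw [inner_sub_right, real_inner_comm x a, real_inner_comm y a]; ring
    rw [this, Real.exp_add]; ring
  have heq : ∫ a in K, Real.exp (inner ℝ y a) * ((Real.exp (inner ℝ a (x - y)) - Real.exp b)
        * (inner ℝ a (x - y) - b)) =
      (∫ a in K, Real.exp (inner ℝ x a) * inner ℝ a (x - y))
        - b * ∫ a in K, Real.exp (inner ℝ x a) := by
    simp_rw [← key]
    rw [integral_sub (hc (by fun_prop)) (hc (by fun_prop)), integral_const_mul, integral_neg, h,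
      integral_sub (hc (by fun_prop)) (hc (by fun_prop)), integral_const_mul]
    ring
  rw [← sub_pos, ← heq]
  have hpos : ∀ t : ℝ, t ≠ b → 0 < (Real.exp t - Real.exp b) * (t - b) := by
    intro t ht
    rcases lt_or_gt_of_ne ht with ht | ht
    · exact mul_pos_of_neg_of_neg (sub_neg.2 (Real.exp_lt_exp.2 ht)) (sub_neg.2 ht)
    · exact mul_pos (sub_pos.2 (Real.exp_lt_exp.2 ht)) (sub_pos.2 ht)
  rw [setIntegral_pos_iff_support_of_nonneg_ae ?_ (hc (by fun_prop))]
  · have hopen : IsOpen ({a : E | inner ℝ a (x - y) ≠ b} ∩ interior K) :=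
      (isOpen_ne_fun (by fun_prop) continuous_const).inter isOpen_interior
    refine (hopen.measure_pos volume ?_).trans_le (measure_mono ?_)
    · obtain ⟨p, hp⟩ := hKint
      by_contra hempty
      have hall : ∀ a ∈ interior K, inner ℝ a (x - y) = b := fun a ha => by
        by_contra hne
        exact hempty ⟨a, hne, ha⟩
      have hcont : Filter.Tendsto (fun t : ℝ => p + t • (x - y)) (nhds 0) (nhds p) := by
        have : Continuous fun t : ℝ => p + t • (x - y) := by fun_prop
        simpa using this.tendsto 0
      obtain ⟨t, ht, ht0⟩ := (((hcont.eventually (isOpen_interior.mem_nhds hp)).filter_mono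
        nhdsWithin_le_nhds).and (self_mem_nhdsWithin (s := Set.Ioi (0 : ℝ)))).exists
      have h1 := hall _ ht
      rw [inner_add_left, hall p hp, inner_smul_left] at h1
      have h2 : (0 : ℝ) < t := ht0
      have h3 : x - y = 0 := by
        simpa [h2.ne'] using h1
      exact hxy (sub_eq_zero.1 h3)
    · rintro a ⟨ha, haK⟩
      exact ⟨(mul_pos (Real.exp_pos _) (hpos _ ha)).ne', interior_subset haK⟩
  · refine Filter.Eventually.of_forall fun a => mul_nonneg (Real.exp_pos _).le ?_
    by_cases ha : inner ℝ a (x - y) = b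
    · simp [ha]
    · exact (hpos _ ha).le

theorem exists_mul_norm_sub_le_log_laplace {K : Set E} (hK : IsCompact K) {q : E}
    (hq : q ∈ interior K) :
    ∃ ε > 0, ∃ C, ∀ x,
      ε * ‖x‖ - C ≤ Real.log (∫ a in K, Real.exp (inner ℝ x a)) - inner ℝ q x := by
  obtain ⟨r, hr, hball⟩ := Metric.mem_nhds_iff.1 (mem_interior_iff_mem_nhds.1 hq)
  set ε := r / 4 with hε
  have hε0 : 0 < ε := by positivity
  set V := volume.real (ball (0 : E) ε)
  have hV : 0 < V := ENNReal.toReal_pos (measure_ball_pos _ _ hε0).ne' measure_ball_lt_top.ne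
  refine ⟨ε, hε0, -Real.log V, fun x => ?_⟩
  set u := ‖x‖⁻¹ • x
  have hu : ‖u‖ ≤ 1 := by
    simp only [u, norm_smul, norm_inv, norm_norm]
    exact inv_mul_le_one
  have hux : inner ℝ u x = ‖x‖ := by
    rcases eq_or_ne x 0 with rfl | hx
    · simp
    · simp only [u, inner_smul_left, real_inner_self_eq_norm_sq]
      have : ‖x‖ ≠ 0 := norm_ne_zero_iff.2 hx
      simp; field_simp
  have hsub : ball (q + (2 * ε) • u) ε ⊆ K := by
    refine Set.Subset.trans (fun a ha => ?_) hball
    rw [mem_ball_iff_norm] at ha ⊢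
    calc ‖a - q‖ = ‖(a - (q + (2 * ε) • u)) + (2 * ε) • u‖ := by congr 1; abel
      _ ≤ ‖a - (q + (2 * ε) • u)‖ + ‖(2 * ε) • u‖ := norm_add_le _ _
      _ < ε + 2 * ε * 1 := by
          refine add_lt_add_of_lt_of_le ha ?_
          rw [norm_smul, Real.norm_of_nonneg (by positivity)]
          gcongr
      _ ≤ r := by linarith
  have hlow : ∀ a ∈ ball (q + (2 * ε) • u) ε, inner ℝ q x + ε * ‖x‖ ≤ inner ℝ x a := by
    intro a ha
    rw [mem_ball_iff_norm] at ha
    have h1 : inner ℝ x a = inner ℝ q x + 2 * ε * ‖x‖ + inner ℝ (a - (q + (2 * ε) • u)) x := by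
      rw [inner_sub_left, inner_add_left, inner_smul_left, hux, real_inner_comm x a]
      simp
    have h2 : -(ε * ‖x‖) ≤ inner ℝ (a - (q + (2 * ε) • u)) x :=
      (neg_le_neg (mul_le_mul_of_nonneg_right ha.le (norm_nonneg _))).trans
        (neg_le_of_abs_le (abs_real_inner_le_norm _ _))
    linarith
  have hint : IntegrableOn (fun a => Real.exp (inner ℝ x a)) K := by
    simpa using integrableOn_exp_inner_smul hK (continuous_const (y := (1 : ℝ))) x
  have hle : Real.exp (inner ℝ q x + ε * ‖x‖) * V ≤ ∫ a in K, Real.exp (inner ℝ x a) := by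
    calc Real.exp (inner ℝ q x + ε * ‖x‖) * V
        = ∫ _ in ball (q + (2 * ε) • u) ε, Real.exp (inner ℝ q x + ε * ‖x‖) := by
          rw [setIntegral_const, smul_eq_mul, mul_comm]
          simp only [V, Measure.real, Measure.addHaar_ball_center]
      _ ≤ ∫ a in ball (q + (2 * ε) • u) ε, Real.exp (inner ℝ x a) :=
          setIntegral_mono_on (integrableOn_const (hs := measure_ball_lt_top.ne))
            (hint.mono_set hsub) measurableSet_ball
            fun a ha => Real.exp_le_exp.2 (hlow a ha)
      _ ≤ ∫ a in K, Real.exp (inner ℝ x a) :=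
          setIntegral_mono_set hint (Filter.Eventually.of_forall fun a => (Real.exp_pos _).le)
            hsub.eventuallyLE
  have hlog := Real.log_le_log (by positivity) hle
  rw [Real.log_mul (Real.exp_pos _).ne' hV.ne', Real.log_exp] at hlog
  linarith

theorem exists_isGradientPotential {K : Set E} (hK : IsCompact K) (hKconv : Convex ℝ K)
    (hKint : (interior K).Nonempty) : ∃ f g g', IsGradientPotential K f g g' := by
  set Z : E → ℝ := fun x => ∫ a in K, Real.exp (inner ℝ x a)
  set W : E → E := fun x => ∫ a in K, Real.exp (inner ℝ x a) • a
  have hZpos : ∀ x, 0 < Z x := laplace_pos hK hKint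
  have hWd : ∀ x, DifferentiableAt ℝ W x := fun x =>
    (hasFDerivAt_integral_exp_inner_smul hK continuous_id x).differentiableAt
  have hZd : ∀ x, HasFDerivAt Z (innerSL ℝ (W x)) x := by
    intro x
    have h := hasFDerivAt_integral_exp_inner_smul hK (continuous_const (y := (1 : ℝ))) x
    simp only [smul_eq_mul, mul_one] at h
    have he : innerSL ℝ (W x) =
        ∫ a in K, Real.exp (inner ℝ x a) • (innerSL ℝ a).smulRight (1 : ℝ) := by
      change innerSL ℝ (∫ a in K, Real.exp (inner ℝ x a) • id a) = _
      rw [← ContinuousLinearMap.integral_comp_comm _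
        (integrableOn_exp_inner_smul hK continuous_id x)]
      congr with a z
      simp
      rfl
    rw [he]
    exact h
  have hinner : ∀ x v, inner ℝ (W x) v = ∫ a in K, Real.exp (inner ℝ x a) * inner ℝ a v := by
    intro x v
    rw [real_inner_comm]
    change inner ℝ v (∫ a in K, Real.exp (inner ℝ x a) • id a) = _
    rw [← integral_inner (integrableOn_exp_inner_smul hK continuous_id x)]
    congr with a
    simp [inner_smul_right, real_inner_comm]
  refine ⟨fun x => Real.log (Z x), fun x => (Z x)⁻¹ • W x,
    fun x => fderiv ℝ (fun x => (Z x)⁻¹ • W x) x, ?_, ?_, ?_, ?_, ?_⟩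
  · intro x
    convert (hZd x).log (hZpos x).ne' using 1
    simp
  · intro x
    exact (((hZd x).differentiableAt.inv (hZpos x).ne').smul (hWd x)).hasFDerivAt
  · exact laplace_barycenter_mem hK hKconv hKint
  · intro x y hxy
    have h := mul_laplace_lt_integral_exp_mul_inner hK hKint hxy
      (b := inner ℝ ((Z y)⁻¹ • W y) (x - y)) (by
      rw [← hinner, inner_smul_left]
      have := (hZpos y).ne'
      change _ * _ * Z y = _
      simp; field_simp)
    rw [← hinner] at h
    rw [inner_sub_left, sub_pos, inner_smul_left (W x)]
    change _ * Z x < _ at h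
    rw [← lt_div_iff₀ (hZpos x)] at h
    simpa [div_eq_inv_mul] using h
  · exact fun q hq => exists_mul_norm_sub_le_log_laplace hK hq

theorem exists_polynomial_of_forall_integral {α : Type*} [MeasurableSpace α] {μ : Measure α}
    {n : ℕ} {p : α → Polynomial ℝ} (hdeg : ∀ x, (p x).natDegree ≤ n)
    (hint : ∀ s : ℝ, 0 ≤ s → Integrable (fun x => (p x).eval s) μ) :
    ∃ R : Polynomial ℝ, R.natDegree ≤ n ∧ ∀ s : ℝ, 0 ≤ s → R.eval s = ∫ x, (p x).eval s ∂μ := by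
  have hinj : Set.InjOn (fun i : ℕ => (i : ℝ)) (Finset.range (n + 1) : Set ℕ) :=
    Nat.cast_injective.injOn
  refine ⟨Lagrange.interpolate (Finset.range (n + 1)) (fun i : ℕ => (i : ℝ))
    fun i : ℕ => ∫ x, (p x).eval (i : ℝ) ∂μ, ?_, fun s _ => ?_⟩
  · have := Lagrange.degree_interpolate_lt (fun i : ℕ => ∫ x, (p x).eval (i : ℝ) ∂μ) hinj
    rw [Finset.card_range] at this
    exact Polynomial.natDegree_le_of_degree_le (Order.lt_succ_iff.1 this)
  · have hp : ∀ x, (p x).eval s = ∑ i ∈ Finset.range (n + 1), (p x).eval (i : ℝ) *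
        (Lagrange.basis (Finset.range (n + 1)) (fun i : ℕ => (i : ℝ)) i).eval s := by
      intro x
      conv_lhs => rw [Lagrange.eq_interpolate (f := p x) hinj (by
        rw [Finset.card_range]
        exact (Polynomial.degree_le_of_natDegree_le (hdeg x)).trans_lt (by
          exact_mod_cast Nat.lt_succ_self n))]
      simp [Lagrange.interpolate_apply, Polynomial.eval_finsetSum]
    simp_rw [hp]
    rw [integral_finsetSum _ fun i _ => (hint _ (Nat.cast_nonneg i)).mul_const _]
    simp [Lagrange.interpolate_apply, Polynomial.eval_finsetSum, integral_mul_const]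

/-- Minkowski's theorem for two convex bodies: the volume of `K + s • M` is a polynomial in
`s ≥ 0`. -/
theorem exists_polynomial_volume_add_smul {K M : Set E} (hK : IsCompact K) (hKconv : Convex ℝ K)
    (hKint : (interior K).Nonempty) (hM : IsCompact M) (hMconv : Convex ℝ M)
    (hMint : (interior M).Nonempty) :
    ∃ R : Polynomial ℝ, R.natDegree ≤ Module.finrank ℝ E ∧
      ∀ s : ℝ, 0 ≤ s → R.eval s = (volume (K + s • M)).toReal := by
  obtain ⟨f₁, g₁, g₁', h₁⟩ := exists_isGradientPotential hK hKconv hKint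
  obtain ⟨f₂, g₂, g₂', h₂⟩ := exists_isGradientPotential hM hMconv hMint
  choose p hpdeg hp using fun x => exists_polynomial_eval_eq_det (g₁' x) (g₂' x)
  have hder : ∀ (s : ℝ) x, HasFDerivAt (fun x => g₁ x + s • g₂ x) (g₁' x + s • g₂' x) x :=
    fun s x => (h₁.hasFDerivAt_grad x).add ((h₂.hasFDerivAt_grad x).const_smul s)
  have hinj : ∀ s : ℝ, 0 ≤ s → Set.InjOn (fun x => g₁ x + s • g₂ x) Set.univ := by
    intro s hs x _ y _ hxy
    by_contra hne
    have := h₁.inner_add_smul_pos h₂ hs hne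
    simp only at hxy
    simp [hxy] at this
  have hdet : ∀ s : ℝ, 0 ≤ s → ∀ x, |(g₁' x + s • g₂' x).det| = (p x).eval s := by
    intro s hs x
    rw [hp, abs_of_nonneg]
    refine det_nonneg_of_inner_nonneg (inner_fderiv_nonneg_of_monotone (hder s x) fun y => ?_)
    rcases eq_or_ne y x with rfl | hyx
    · simp
    · exact (h₁.inner_add_smul_pos h₂ hs hyx).le
  have hsub : ∀ s : ℝ, (Set.range fun x => g₁ x + s • g₂ x) ⊆ K + s • M := by
    rintro s _ ⟨x, rfl⟩
    exact Set.add_mem_add (h₁.grad_mem x) (Set.smul_mem_smul_set (h₂.grad_mem x))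
  have hcomp : ∀ s : ℝ, IsCompact (K + s • M) := fun s => hK.add (hM.smul s)
  have hvol : ∀ s : ℝ, 0 ≤ s →
      volume (Set.range fun x => g₁ x + s • g₂ x) = volume (K + s • M) := by
    intro s hs
    refine le_antisymm (measure_mono (hsub s)) ?_
    have hconv : Convex ℝ (interior K + s • interior M) :=
      hKconv.interior.add (hMconv.interior.smul s)
    have hcl : K + s • M ⊆ closure (interior K + s • interior M) := by
      rintro _ ⟨k, hk, _, ⟨m, hm, rfl⟩, rfl⟩
      have hk' : k ∈ closure (interior K) := by
        rw [hKconv.closure_interior_eq_closure_of_nonempty_interior hKint]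
        exact subset_closure hk
      have hm' : m ∈ closure (interior M) := by
        rw [hMconv.closure_interior_eq_closure_of_nonempty_interior hMint]
        exact subset_closure hm
      exact map_mem_closure₂ (f := fun a b => a + s • b) (by fun_prop) hk' hm'
        fun a ha b hb => Set.add_mem_add ha (Set.smul_mem_smul_set hb)
    calc volume (K + s • M) ≤ volume (closure (interior K + s • interior M)) := measure_mono hcl
      _ = volume (interior K + s • interior M) :=
          measure_congr (closure_ae_eq_of_null_frontier (hconv.addHaar_frontier volume))
      _ ≤ _ := measure_mono (h₁.interior_add_smul_subset_range h₂ hs)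
  have hint : ∀ s : ℝ, 0 ≤ s → Integrable (fun x => (p x).eval s) volume := by
    intro s hs
    have h := integrableOn_image_iff_integrableOn_abs_det_fderiv_smul volume MeasurableSet.univ
      (fun x _ => (hder s x).hasFDerivWithinAt) (hinj s hs) (fun _ => (1 : ℝ))
    simp only [smul_eq_mul, mul_one, Set.image_univ, integrableOn_univ, hdet s hs] at h
    refine h.1 (integrableOn_const (hs := ?_))
    rw [hvol s hs]
    exact (hcomp s).measure_ne_top
  obtain ⟨R, hRdeg, hR⟩ := exists_polynomial_of_forall_integral hpdeg hint
  refine ⟨R, hRdeg, fun s hs => ?_⟩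
  have h := integral_image_eq_integral_abs_det_fderiv_smul volume MeasurableSet.univ
    (fun x _ => (hder s x).hasFDerivWithinAt) (hinj s hs) (fun _ => (1 : ℝ))
  simp only [smul_eq_mul, mul_one, Set.image_univ, Measure.restrict_univ, hdet s hs] at h
  rw [hR s hs, ← h, setIntegral_const, Measure.real, hvol s hs, smul_eq_mul, mul_one]

/-- The reflection of the Steiner polynomial of `K` in the radius of a ball of which `K` is a
summand is, up to sign, the Steiner polynomial of the complementary summand `M`. -/
theorem volume_add_smul_closedBall_eq_of_add_eq {K M : Set E} (hK : IsCompact K)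
    (hKconv : Convex ℝ K) (hKint : (interior K).Nonempty) (hM : IsCompact M)
    (hMconv : Convex ℝ M) (hMint : (interior M).Nonempty) {c : ℝ} (hc : 0 < c)
    (hMK : M + K = c • closedBall (0 : E) 1) {P : Polynomial ℝ}
    (hPdeg : P.natDegree ≤ Module.finrank ℝ E)
    (hP : ∀ t : ℝ, 0 ≤ t → P.eval t = (volume (K + t • closedBall (0 : E) 1)).toReal)
    {t : ℝ} (ht : 0 < t) :
    (volume (M + t • closedBall (0 : E) 1)).toReal =
      (-1) ^ Module.finrank ℝ E * P.eval (-(t + c)) := by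
  set d := Module.finrank ℝ E
  set B := closedBall (0 : E) 1
  obtain ⟨R, -, hR⟩ := exists_polynomial_volume_add_smul hK hKconv hKint hM hMconv hMint
  let H : Polynomial ℝ := ∑ k ∈ Finset.range (d + 1),
    Polynomial.C (P.coeff k * c ^ k) * Polynomial.X ^ k * (1 - Polynomial.X) ^ (d - k)
  have hH : ∀ s : ℝ, s ≠ 1 → H.eval s = (1 - s) ^ d * P.eval (s * c / (1 - s)) := by
    intro s hs
    have hs' : 1 - s ≠ 0 := sub_ne_zero.2 hs.symm
    rw [Polynomial.eval_eq_sum_range' (Nat.lt_succ_of_le hPdeg), Finset.mul_sum]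
    simp only [H, Polynomial.eval_finsetSum]
    refine Finset.sum_congr rfl fun k hk => ?_
    obtain ⟨j, hj⟩ := Nat.exists_eq_add_of_le (Nat.lt_succ_iff.1 (Finset.mem_range.1 hk))
    rw [hj, Nat.add_sub_cancel_left]
    simp only [Polynomial.eval_mul, Polynomial.eval_C, Polynomial.eval_pow, Polynomial.eval_X,
      Polynomial.eval_sub, Polynomial.eval_one, div_pow]
    field_simp
    ring
  have hsmul : ∀ {r : ℝ} (S : Set E), 0 ≤ r →
      (volume (r • S)).toReal = r ^ d * (volume S).toReal := by
    intro r S hr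
    rw [Measure.addHaar_smul, ENNReal.toReal_mul, abs_of_nonneg (pow_nonneg hr _),
      ENNReal.toReal_ofReal (pow_nonneg hr _)]
  have hRH : R = H := by
    refine Polynomial.eq_of_infinite_eval_eq _ _ ((Set.Ioo_infinite one_pos).mono ?_)
    intro s hs
    have hs1 : 0 < 1 - s := sub_pos.2 hs.2
    have hset : K + s • M = (1 - s) • (K + (s * c / (1 - s)) • B) := by
      rw [smul_add, smul_smul, mul_div_cancel₀ _ hs1.ne', ← smul_smul, ← hMK, smul_add,
        add_comm (s • M), ← add_assoc, ← hKconv.add_smul hs1.le hs.1.le, sub_add_cancel, one_smul]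
    rw [Set.mem_ofPred_eq, hH s hs.2.ne, hR s hs.1.le, hset, hsmul _ hs1.le,
      hP _ (div_nonneg (mul_nonneg hs.1.le hc.le) hs1.le)]
  have hct : 0 < c / t := div_pos hc ht
  have hset : K + (1 + c / t) • M = (c / t) • (M + t • B) := by
    rw [smul_add, smul_smul, div_mul_cancel₀ _ ht.ne', ← hMK,
      hMconv.add_smul zero_le_one hct.le, one_smul]
    abel
  have h := hR (1 + c / t) (by positivity)
  rw [hRH, hH _ (by simpa using hct.ne'), hset, hsmul _ hct.le] at h
  have h1 : 1 - (1 + c / t) = -1 * (c / t) := by ring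
  have h2 : (1 + c / t) * c / (-1 * (c / t)) = -(t + c) := by field_simp
  rw [h1, h2, mul_pow] at h
  refine mul_left_cancel₀ (pow_pos hct d).ne' ?_
  rw [← h]
  ring

end Volume

/-- **Lower bound on the roots of the Steiner polynomial.** Assume the Steiner polynomial
of every convex body with nonempty interior in `ℝⁿ` is stable. If the convex body `K` is
a Minkowski summand of `cB` (in particular whenever `c ≥ ρ_max`, the maximum principal
radius of curvature of a `C²` body `K`), then every complex root `z` of the Steiner
polynomial of `K` satisfies `Re z ≥ -c`. -/
theorem steiner_roots_ge_neg_c (n : ℕ) (hn : 1 ≤ n)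
    (hstab : ∀ L : Set (EuclideanSpace ℝ (Fin n)), L.Nonempty → IsCompact L → Convex ℝ L →
      (interior L).Nonempty → ∀ Q : Polynomial ℝ, Q.natDegree ≤ n →
      (∀ t : ℝ, 0 ≤ t →
        Q.eval t = (volume (L + t • closedBall (0 : EuclideanSpace ℝ (Fin n)) 1)).toReal) →
      ∀ z : ℂ, Polynomial.aeval z Q = 0 → z.re < 0)
    (K : Set (EuclideanSpace ℝ (Fin n)))
    (hKne : K.Nonempty) (hKcomp : IsCompact K) (hKconv : Convex ℝ K)
    (hKint : (interior K).Nonempty)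
    (c : ℝ) (hc : 0 < c)
    (hsummand : ∃ M : Set (EuclideanSpace ℝ (Fin n)), M.Nonempty ∧ IsCompact M ∧
      Convex ℝ M ∧ M + K = c • closedBall (0 : EuclideanSpace ℝ (Fin n)) 1)
    (P : Polynomial ℝ) (hPdeg : P.natDegree ≤ n)
    (hP : ∀ t : ℝ, 0 ≤ t →
      P.eval t = (volume (K + t • closedBall (0 : EuclideanSpace ℝ (Fin n)) 1)).toReal) :
    ∀ z : ℂ, Polynomial.aeval z P = 0 → -c ≤ z.re := by
  intro z hz
  obtain ⟨M, hMne, hMcomp, hMconv, hMK⟩ := hsummand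
  set B := closedBall (0 : EuclideanSpace ℝ (Fin n)) 1
  have hBconv : Convex ℝ B := convex_closedBall _ _
  have hBcomp : IsCompact B := isCompact_closedBall _ _
  refine le_of_forall_pos_lt_add fun δ hδ => ?_
  set ε := δ / 2
  have hε : 0 < ε := half_pos hδ
  have hadd : ∀ {A : Set (EuclideanSpace ℝ (Fin n))}, A.Nonempty →
      (interior (A + ε • B)).Nonempty := by
    rintro A ⟨a, ha⟩
    refine ⟨a, mem_interior_iff_mem_nhds.2 (Filter.mem_of_superset
      (closedBall_mem_nhds a hε) fun x hx => ⟨a, ha, x - a, ?_, by simp⟩)⟩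
    rw [smul_unitClosedBall_of_nonneg hε.le, mem_closedBall_zero_iff]
    exact mem_closedBall_iff_norm.1 hx
  have hεcomp : ∀ {A : Set (EuclideanSpace ℝ (Fin n))}, IsCompact A → IsCompact (A + ε • B) :=
    fun hA => hA.add (hBcomp.smul ε)
  have hεconv : ∀ {A : Set (EuclideanSpace ℝ (Fin n))}, Convex ℝ A → Convex ℝ (A + ε • B) :=
    fun hA => hA.add (hBconv.smul ε)
  have hM₁K : M + ε • B + K = (c + ε) • B := by
    rw [hBconv.add_smul hc.le hε.le, ← hMK]
    abel
  have hM₁ne : (M + ε • B).Nonempty := (hadd hMne).mono interior_subset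
  have hre := hstab (M + ε • B + ε • B) ((hadd hM₁ne).mono interior_subset)
    (hεcomp (hεcomp hMcomp)) (hεconv (hεconv hMconv)) (hadd hM₁ne)
    (Polynomial.C ((-1) ^ n) * P.comp (-Polynomial.X - Polynomial.C (c + δ))) ?_ ?_
    (-z - (c + δ)) ?_
  · simp at hre
    linarith
  · refine (Polynomial.natDegree_C_mul_le _ _).trans (Polynomial.natDegree_comp_le.trans ?_)
    have h1 : (-Polynomial.X - Polynomial.C (c + δ)).natDegree ≤ 1 := by compute_degree
    exact (Nat.mul_le_mul hPdeg h1).trans_eq (mul_one n)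
  · intro t ht
    have h := volume_add_smul_closedBall_eq_of_add_eq hKcomp hKconv hKint (hεcomp hMcomp)
      (hεconv hMconv) (hadd hMne) (add_pos hc hε) hM₁K (by simpa using hPdeg) hP
      (add_pos_of_pos_of_nonneg hε ht)
    rw [add_assoc, ← hBconv.add_smul hε.le ht, h, finrank_euclideanSpace_fin]
    simp only [Polynomial.eval_mul, Polynomial.eval_C, Polynomial.eval_comp, Polynomial.eval_sub,
      Polynomial.eval_neg, Polynomial.eval_X]
    congr 2
    simp only [ε]
    ring
  · simp [Polynomial.aeval_comp, hz]
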